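/- arXiv:1907.04617 — 2 statements merged into one kernel-verified Lean document; each statement's English description precedes it below -/
import Mathlib

section
/- Let n > 1 and let L be the second order cone in ℝ^n with boundary ∂L = {(t,u) : t = ‖u‖}. A matrix A ∈ ℝ^{n×n} is a Z-transformation on L if and only if there exist a real number γ, a symmetric matrix P that is copositive on ∂L (i.e., xᵀPx ≥ 0 for all x ∈ ∂L), and a skew-symmetric matrix Q such that A = γ·I − J(P + Q), where J = diag(1,−1,…,−1). -/
open Matrix

noncomputable section

/-- The second order cone in `ℝⁿ`: `{(t,u) : t ≥ ‖u‖}` (first coordinate is `t`). -/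
def soc (n : ℕ) [NeZero n] : Set (Fin n → ℝ) :=
  {x | Real.sqrt (∑ i, if i = 0 then 0 else (x i) ^ 2) ≤ x 0}

/-- The boundary of the second order cone: `{(t,u) : t = ‖u‖}`. -/
def socBd (n : ℕ) [NeZero n] : Set (Fin n → ℝ) :=
  {x | Real.sqrt (∑ i, if i = 0 then 0 else (x i) ^ 2) = x 0}

/-- `J = diag(1, -1, …, -1)`. -/
def Jmat (n : ℕ) [NeZero n] : Matrix (Fin n) (Fin n) ℝ :=
  Matrix.diagonal (fun i => if i = 0 then 1 else -1)

/-- The dual cone of a set `K ⊆ ℝⁿ`. -/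
def dualCone {n : ℕ} (K : Set (Fin n → ℝ)) : Set (Fin n → ℝ) :=
  {y | ∀ x ∈ K, 0 ≤ x ⬝ᵥ y}

/-- `A` is a Z-transformation on `K`: `x ∈ K`, `y ∈ K*`, `⟨x,y⟩ = 0` imply `⟨Ax,y⟩ ≤ 0`. -/
def IsZTransf {n : ℕ} (K : Set (Fin n → ℝ)) (A : Matrix (Fin n) (Fin n) ℝ) : Prop :=
  ∀ x ∈ K, ∀ y ∈ dualCone K, x ⬝ᵥ y = 0 → (A.mulVec x) ⬝ᵥ y ≤ 0

/-- The completely positive cone of `C`: all finite sums `∑ uᵢuᵢᵀ` with `uᵢ ∈ C`. -/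
def cpCone {n : ℕ} (C : Set (Fin n → ℝ)) : Set (Matrix (Fin n) (Fin n) ℝ) :=
  {X | ∃ (m : ℕ) (u : Fin m → Fin n → ℝ), (∀ i, u i ∈ C) ∧ X = ∑ i, vecMulVec (u i) (u i)}

/-- The copositive cone of `C`: symmetric matrices `A` with `xᵀAx ≥ 0` for all `x ∈ C`. -/
def copCone {n : ℕ} (C : Set (Fin n → ℝ)) : Set (Matrix (Fin n) (Fin n) ℝ) :=
  {A | Aᵀ = A ∧ ∀ x ∈ C, 0 ≤ x ⬝ᵥ A.mulVec x}

/-- `Ω = {(x,y) ∈ L × L : ‖x‖ = 1 = ‖y‖, ⟨x,y⟩ = 0}`. -/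
def OmegaSet (n : ℕ) [NeZero n] : Set ((Fin n → ℝ) × (Fin n → ℝ)) :=
  {p | p.1 ∈ soc n ∧ p.2 ∈ soc n ∧ Real.sqrt (∑ i, p.1 i ^ 2) = 1 ∧
       Real.sqrt (∑ i, p.2 i ^ 2) = 1 ∧ p.1 ⬝ᵥ p.2 = 0}

/-- `γ(A) = max {⟨Ax,y⟩ : (x,y) ∈ Ω}`. -/
def gammaFun (n : ℕ) [NeZero n] (A : Matrix (Fin n) (Fin n) ℝ) : ℝ :=
  sSup {r | ∃ p ∈ OmegaSet n, r = (A.mulVec p.1) ⬝ᵥ p.2}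

theorem sum_eq_zero_add {n : ℕ} [NeZero n] (f : Fin n → ℝ) :
    ∑ i, f i = f 0 + ∑ i, if i = 0 then 0 else f i := by
  have h : f 0 = ∑ i, if i = 0 then f i else 0 := by simp
  rw [h, ← Finset.sum_add_distrib]
  exact Finset.sum_congr rfl fun i _ => by split_ifs <;> simp

theorem mem_soc_iff {n : ℕ} [NeZero n] (x : Fin n → ℝ) :
    x ∈ soc n ↔ 0 ≤ x 0 ∧ ∑ i, (if i = 0 then 0 else x i ^ 2) ≤ x 0 ^ 2 :=
  Real.sqrt_le_iff

theorem sum_tail_sq_nonneg {n : ℕ} [NeZero n] (x : Fin n → ℝ) :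
    0 ≤ ∑ i, (if i = 0 then 0 else x i ^ 2) :=
  Finset.sum_nonneg fun i _ => by split_ifs <;> positivity

theorem mem_socBd_iff {n : ℕ} [NeZero n] (x : Fin n → ℝ) :
    x ∈ socBd n ↔ 0 ≤ x 0 ∧ ∑ i, (if i = 0 then 0 else x i ^ 2) = x 0 ^ 2 := by
  constructor
  · intro h
    have h : Real.sqrt (∑ i, if i = 0 then 0 else (x i) ^ 2) = x 0 := h
    rw [← h, Real.sq_sqrt (sum_tail_sq_nonneg x)]
    exact ⟨Real.sqrt_nonneg _, rfl⟩
  · rintro ⟨h0, h⟩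
    change Real.sqrt (∑ i, if i = 0 then 0 else (x i) ^ 2) = x 0
    rw [h, Real.sqrt_sq h0]

theorem Jmat_mulVec_apply {n : ℕ} [NeZero n] (x : Fin n → ℝ) (i : Fin n) :
    (Jmat n *ᵥ x) i = if i = 0 then x i else - x i := by
  rw [Jmat, mulVec_diagonal]
  split_ifs <;> simp

theorem Jmat_mul_self (n : ℕ) [NeZero n] : Jmat n * Jmat n = 1 := by
  rw [Jmat, diagonal_mul_diagonal, ← diagonal_one]
  congr 1
  funext i
  split_ifs <;> simp

theorem Jmat_mulVec_dotProduct_Jmat_mulVec {n : ℕ} [NeZero n] (x y : Fin n → ℝ) :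
    (Jmat n *ᵥ x) ⬝ᵥ (Jmat n *ᵥ y) = x ⬝ᵥ y := by
  refine Finset.sum_congr rfl fun i _ => ?_
  rw [Jmat_mulVec_apply, Jmat_mulVec_apply]
  split_ifs <;> ring

theorem Jmat_mulVec_dotProduct {n : ℕ} [NeZero n] (x y : Fin n → ℝ) :
    (Jmat n *ᵥ x) ⬝ᵥ y = x ⬝ᵥ (Jmat n *ᵥ y) := by
  refine Finset.sum_congr rfl fun i _ => ?_
  rw [Jmat_mulVec_apply, Jmat_mulVec_apply]
  split_ifs <;> ring

theorem sum_tail_sq_add_smul {n : ℕ} [NeZero n] (c : ℝ) (x y : Fin n → ℝ) :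
    ∑ i, (if i = 0 then 0 else (y i + c * x i) ^ 2) =
      ∑ i, (if i = 0 then 0 else y i ^ 2) + 2 * c * (x ⬝ᵥ y - x 0 * y 0) +
        c ^ 2 * ∑ i, (if i = 0 then 0 else x i ^ 2) := by
  have h : x ⬝ᵥ y - x 0 * y 0 = ∑ i, if i = 0 then 0 else x i * y i := by
    rw [dotProduct, sum_eq_zero_add]
    ring
  rw [h, Finset.mul_sum, Finset.mul_sum, ← Finset.sum_add_distrib, ← Finset.sum_add_distrib]
  exact Finset.sum_congr rfl fun i _ => by split_ifs <;> ring

theorem eq_zero_of_sum_tail_sq_nonpos {n : ℕ} [NeZero n] {x : Fin n → ℝ}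
    (h : ∑ i, (if i = 0 then 0 else x i ^ 2) ≤ 0) {i : Fin n} (hi : i ≠ 0) : x i = 0 := by
  have h0 := (Finset.sum_eq_zero_iff_of_nonneg
    (fun i _ => by split_ifs <;> positivity)).1
    (le_antisymm h (sum_tail_sq_nonneg x)) i (Finset.mem_univ i)
  simpa [hi] using h0

/-- The second order cone is self-dual. -/
theorem mem_dualCone_soc_iff {n : ℕ} [NeZero n] (y : Fin n → ℝ) :
    y ∈ dualCone (soc n) ↔ y ∈ soc n := by
  constructor
  · intro hy
    have h0 : 0 ≤ y 0 := by
      have h := hy (Pi.single 0 1) ((mem_soc_iff _).2 ⟨by simp, ?_⟩)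
      · simpa using h
      · rw [Finset.sum_eq_zero fun i _ => ?_]
        · positivity
        · split_ifs with hi <;> simp [hi]
    let r := Real.sqrt (∑ i, if i = 0 then 0 else y i ^ 2)
    have hr0 : 0 ≤ r := Real.sqrt_nonneg _
    have hr : ∑ i, (if i = 0 then 0 else y i ^ 2) = r ^ 2 :=
      (Real.sq_sqrt (sum_tail_sq_nonneg y)).symm
    have h := hy (fun i => if i = 0 then r else - y i) ((mem_soc_iff _).2 ⟨by simpa, ?_⟩)
    · rw [dotProduct, sum_eq_zero_add] at h
      have h1 : ∑ i, (if i = 0 then 0 else (if i = 0 then r else - y i) * y i) = - r ^ 2 := by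
        rw [← hr, ← Finset.sum_neg_distrib]
        exact Finset.sum_congr rfl fun i _ => by split_ifs <;> ring
      rw [h1] at h
      simp only [if_true] at h
      change r ≤ y 0
      by_contra! hlt
      nlinarith
    · simp only [if_true, ← hr]
      exact (Finset.sum_congr rfl fun i _ => by split_ifs <;> ring).le
  · intro hy x hx
    obtain ⟨hx0, hx⟩ := (mem_soc_iff x).1 hx
    obtain ⟨hy0, hy⟩ := (mem_soc_iff y).1 hy
    rcases hx0.eq_or_lt with h0 | h0
    · rw [← h0] at hx
      have hz : x = 0 := by
        funext i
        by_cases hi : i = 0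
        · rw [hi, ← h0, Pi.zero_apply]
        · exact eq_zero_of_sum_tail_sq_nonpos (by simpa using hx) hi
      simp [hz]
    · have h := sum_tail_sq_nonneg fun i => y i + y 0 / x 0 * x i
      rw [sum_tail_sq_add_smul] at h
      set c := y 0 / x 0 with hc
      have hcx : y 0 = c * x 0 := by rw [hc]; field_simp
      have hc0 : 0 ≤ c := by positivity
      rcases hc0.eq_or_lt with hc1 | hc1
      · rw [hcx, ← hc1] at hy
        rw [dotProduct, sum_eq_zero_add, hcx, ← hc1, Finset.sum_eq_zero fun i _ => ?_]
        · simp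
        · split_ifs with hi
          · rfl
          · rw [eq_zero_of_sum_tail_sq_nonpos (x := y) (by simpa using hy) hi, mul_zero]
      · have h2 : c ^ 2 * ∑ i, (if i = 0 then 0 else x i ^ 2) ≤ c ^ 2 * x 0 ^ 2 := by gcongr
        rw [hcx] at h hy
        have : 0 ≤ c * (x ⬝ᵥ y) := by nlinarith
        exact nonneg_of_mul_nonneg_right this hc1

/-- Complementary vectors of the second order cone, the first being nonzero, are proportional up to
reflection by `J`; the first is a boundary point unless the second vanishes. -/
theorem exists_eq_smul_Jmat_mulVec {n : ℕ} [NeZero n] {x y : Fin n → ℝ} (hx : x ∈ soc n)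
    (hy : y ∈ soc n) (hxy : x ⬝ᵥ y = 0) (hne : x ≠ 0) :
    ∃ c : ℝ, 0 ≤ c ∧ y = c • (Jmat n *ᵥ x) ∧ (c = 0 ∨ x ∈ socBd n) := by
  obtain ⟨hx0, hx⟩ := (mem_soc_iff x).1 hx
  obtain ⟨hy0, hy⟩ := (mem_soc_iff y).1 hy
  have hpos : 0 < x 0 := by
    refine hx0.lt_of_ne fun h0 => hne ?_
    rw [← h0] at hx
    funext i
    by_cases hi : i = 0
    · rw [hi, ← h0, Pi.zero_apply]
    · exact eq_zero_of_sum_tail_sq_nonpos (by simpa using hx) hi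
  have hsum := sum_tail_sq_add_smul (y 0 / x 0) x y
  have hnn := sum_tail_sq_nonneg fun i => y i + y 0 / x 0 * x i
  set c := y 0 / x 0 with hc
  have hcx : y 0 = c * x 0 := by rw [hc]; field_simp
  have hc0 : 0 ≤ c := by positivity
  rw [hxy, hcx] at hsum
  rw [hcx] at hy
  have hcx2 : c ^ 2 * ∑ i, (if i = 0 then 0 else x i ^ 2) ≤ c ^ 2 * x 0 ^ 2 := by gcongr
  refine ⟨c, hc0, ?_, ?_⟩
  · funext i
    rw [Pi.smul_apply, smul_eq_mul, Jmat_mulVec_apply]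
    split_ifs with hi
    · rw [hi, hcx]
    · have := eq_zero_of_sum_tail_sq_nonpos (x := fun i => y i + c * x i) (by nlinarith) hi
      linarith
  · rcases hc0.eq_or_lt with h | h
    · exact Or.inl h.symm
    · refine Or.inr ((mem_socBd_iff x).2 ⟨hx0, ?_⟩)
      have h2 : c ^ 2 * ∑ i, (if i = 0 then 0 else x i ^ 2) = c ^ 2 * x 0 ^ 2 := by nlinarith
      exact mul_left_cancel₀ (by positivity) h2

theorem dotProduct_Jmat_mulVec_self {n : ℕ} [NeZero n] {x : Fin n → ℝ} (hx : x ∈ socBd n) :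
    x ⬝ᵥ (Jmat n *ᵥ x) = 0 := by
  rw [dotProduct, sum_eq_zero_add]
  have h : ∑ i, (if i = 0 then 0 else x i * (Jmat n *ᵥ x) i) = - x 0 ^ 2 := by
    rw [← ((mem_socBd_iff x).1 hx).2, ← Finset.sum_neg_distrib]
    refine Finset.sum_congr rfl fun i _ => ?_
    rw [Jmat_mulVec_apply]
    split_ifs <;> ring
  rw [h, Jmat_mulVec_apply, if_pos rfl]
  ring

theorem Jmat_mulVec_mem_soc {n : ℕ} [NeZero n] {x : Fin n → ℝ} (hx : x ∈ soc n) :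
    Jmat n *ᵥ x ∈ soc n := by
  obtain ⟨h0, h⟩ := (mem_soc_iff x).1 hx
  simp only [mem_soc_iff, Jmat_mulVec_apply, if_true]
  refine ⟨h0, le_of_eq_of_le (Finset.sum_congr rfl fun i _ => ?_) h⟩
  split_ifs <;> ring

theorem dotProduct_transpose_mulVec_self {n : ℕ} (M : Matrix (Fin n) (Fin n) ℝ)
    (x : Fin n → ℝ) : x ⬝ᵥ (Mᵀ *ᵥ x) = x ⬝ᵥ (M *ᵥ x) := by
  rw [mulVec_transpose, dotProduct_comm, dotProduct_mulVec]

theorem stmt2 (n : ℕ) [NeZero n] (hn : 1 < n) (A : Matrix (Fin n) (Fin n) ℝ) :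
    IsZTransf (soc n) A ↔
      ∃ (γ : ℝ) (P Q : Matrix (Fin n) (Fin n) ℝ),
        Pᵀ = P ∧ (∀ x ∈ socBd n, 0 ≤ x ⬝ᵥ P.mulVec x) ∧ Qᵀ = -Q ∧
        A = γ • (1 : Matrix (Fin n) (Fin n) ℝ) - Jmat n * (P + Q) := by
  constructor
  · intro hA
    let M := -(Jmat n * A)
    refine ⟨0, (1 / 2 : ℝ) • (M + Mᵀ), (1 / 2 : ℝ) • (M - Mᵀ), ?_, fun x hx => ?_, ?_, ?_⟩
    · rw [transpose_smul, transpose_add, transpose_transpose, add_comm]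
    · have hxs : x ∈ soc n := le_of_eq hx
      have h := hA x hxs (Jmat n *ᵥ x)
        ((mem_dualCone_soc_iff _).2 (Jmat_mulVec_mem_soc hxs)) (dotProduct_Jmat_mulVec_self hx)
      have hM : x ⬝ᵥ (M *ᵥ x) = -((A *ᵥ x) ⬝ᵥ (Jmat n *ᵥ x)) := by
        rw [neg_mulVec, dotProduct_neg, ← mulVec_mulVec, ← Jmat_mulVec_dotProduct,
          dotProduct_comm]
      rw [smul_mulVec, dotProduct_smul, add_mulVec, dotProduct_add,
        dotProduct_transpose_mulVec_self, hM, smul_eq_mul]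
      linarith
    · rw [transpose_smul, transpose_sub, transpose_transpose, ← smul_neg, neg_sub]
    · have hM : (1 / 2 : ℝ) • (M + Mᵀ) + (1 / 2 : ℝ) • (M - Mᵀ) = M := by module
      rw [hM, mul_neg, ← Matrix.mul_assoc, Jmat_mul_self, Matrix.one_mul, zero_smul, zero_sub,
        neg_neg]
  · rintro ⟨γ, P, Q, -, hP, hQ, rfl⟩ x hx y hy hxy
    by_cases hne : x = 0
    · simp [hne]
    obtain ⟨c, hc, rfl, hcb⟩ :=
      exists_eq_smul_Jmat_mulVec hx ((mem_dualCone_soc_iff y).1 hy) hxy hne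
    rcases hcb with rfl | hb
    · simp
    have hQx : x ⬝ᵥ (Q *ᵥ x) = 0 := by
      have h := dotProduct_transpose_mulVec_self Q x
      rw [hQ, neg_mulVec, dotProduct_neg] at h
      linarith
    rw [sub_mulVec, sub_dotProduct, smul_mulVec, one_mulVec, smul_dotProduct, hxy,
      ← mulVec_mulVec, dotProduct_smul, Jmat_mulVec_dotProduct_Jmat_mulVec, dotProduct_comm,
      add_mulVec, dotProduct_add, hQx, smul_eq_mul, smul_eq_mul]
    have := mul_nonneg hc (hP x hb)
    linarith
end
end

section
/- Let n > 1 and let L be the second order cone in ℝ^n. The dual cone of Z(L) in ℝ^{n×n} (with the trace inner product) equals {B ∈ ℝ^{n×n} : tr(B) = 0 and −JB ∈ K_L}, where K_L is the completely positive cone of L, i.e., the set of finite sums Σᵢ uᵢuᵢᵀ with all uᵢ ∈ L, and J = diag(1,−1,…,−1). -/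
open Matrix

noncomputable section

/-- In a finite-dimensional real topological vector space, the convex hull of a compact set is
compact, by Carathéodory's theorem. -/
theorem IsCompact.convexHull_of_finiteDimensional {E : Type*} [AddCommGroup E] [Module ℝ E]
    [FiniteDimensional ℝ E] [TopologicalSpace E] [IsTopologicalAddGroup E] [ContinuousSMul ℝ E]
    {s : Set E} (hs : IsCompact s) : IsCompact (convexHull ℝ s) := by
  have key : convexHull ℝ s = ⋃ k ∈ Finset.range (Module.finrank ℝ E + 2),
      (fun p : (Fin k → ℝ) × (Fin k → E) => ∑ i, p.1 i • p.2 i) ''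
        (stdSimplex ℝ (Fin k) ×ˢ Set.univ.pi fun _ => s) := by
    apply Set.Subset.antisymm
    · intro x hx
      obtain ⟨ι, _, z, w, hz, hind, hw, hw1, rfl⟩ := eq_pos_convex_span_of_mem_convexHull hx
      have hc : Fintype.card ι ≤ Module.finrank ℝ E + 1 := hind.card_le_finrank_succ.trans
        (Nat.succ_le_succ (Submodule.finrank_le _))
      let e := (Fintype.equivFin ι).symm
      simp only [Set.mem_iUnion, Finset.mem_range]
      refine ⟨Fintype.card ι, by omega, (w ∘ e, z ∘ e), ⟨⟨fun i => (hw _).le, ?_⟩, ?_⟩, ?_⟩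
      · exact (e.sum_comp w).trans hw1
      · exact fun i _ => hz ⟨_, rfl⟩
      · exact e.sum_comp fun i => w i • z i
    · simp only [Set.iUnion_subset_iff]
      rintro k - _ ⟨⟨w, z⟩, ⟨hw, hz⟩, rfl⟩
      exact (convex_convexHull ℝ s).sum_mem (fun i _ => hw.1 i) hw.2
        fun i hi => subset_convexHull ℝ s (hz i (Set.mem_univ i))
  rw [key]
  refine Finset.isCompact_biUnion _ fun k _ => ?_
  refine ((isCompact_stdSimplex ℝ (Fin k)).prod (isCompact_univ_pi fun _ => hs)).image ?_
  fun_prop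

/-- Strict separation of a point from the cone generated by a compact convex set lying in an affine
hyperplane that avoids the origin. -/
theorem exists_strongDual_neg_of_notMem_cone {E : Type*} [AddCommGroup E] [Module ℝ E]
    [TopologicalSpace E] [IsTopologicalAddGroup E] [ContinuousSMul ℝ E] [LocallyConvexSpace ℝ E]
    [T2Space E] {C : Set E} (hconv : Convex ℝ C) (hcomp : IsCompact C) (g : StrongDual ℝ E)
    (hg : ∀ x ∈ C, g x = 1) {d : E} (hd : d ≠ 0) (hcone : ∀ c : ℝ, 0 < c → ∀ x ∈ C, d ≠ c • x) :
    ∃ f : StrongDual ℝ E, (∀ x ∈ C, 0 ≤ f x) ∧ f d < 0 := by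
  rcases le_or_gt (g d) 0 with hgd | hgd
  · obtain ⟨h, hh⟩ := geometric_hahn_banach_point_point hd
    rw [map_zero] at hh
    obtain ⟨k, hk⟩ := (hcomp.image h.continuous).bddBelow
    refine ⟨h + |k| • g, fun x hx => ?_, ?_⟩
    · have := hk (Set.mem_image_of_mem h hx)
      simp [hg x hx]
      linarith [neg_abs_le k]
    · simp only [_root_.add_apply, _root_.smul_apply, smul_eq_mul]
      nlinarith [abs_nonneg k]
  · have hnot : (g d)⁻¹ • d ∉ C := fun hmem =>
      hcone (g d) hgd _ hmem (by rw [smul_inv_smul₀ hgd.ne'])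
    obtain ⟨f, u, hu, hf⟩ := geometric_hahn_banach_point_closed hconv hcomp.isClosed hnot
    refine ⟨f - u • g, fun x hx => ?_, ?_⟩
    · simp [hg x hx, (hf x hx).le]
    · rw [map_smul, smul_eq_mul, inv_mul_lt_iff₀ hgd] at hu
      simp only [_root_.sub_apply, _root_.smul_apply, smul_eq_mul]
      linarith

section CompletelyPositive

variable {n : ℕ} {K : Set (Fin n → ℝ)}

theorem zero_mem_cpCone : 0 ∈ cpCone K := ⟨0, Fin.elim0, fun i => i.elim0, by simp⟩

theorem vecMulVec_self_mem_cpCone {u : Fin n → ℝ} (hu : u ∈ K) : vecMulVec u u ∈ cpCone K :=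
  ⟨1, fun _ => u, fun _ => hu, by simp⟩

theorem add_mem_cpCone {X Y : Matrix (Fin n) (Fin n) ℝ} (hX : X ∈ cpCone K)
    (hY : Y ∈ cpCone K) : X + Y ∈ cpCone K := by
  obtain ⟨k, u, hu, rfl⟩ := hX
  obtain ⟨l, v, hv, rfl⟩ := hY
  refine ⟨k + l, Fin.append u v, fun i => ?_, by simp [Fin.sum_univ_add]⟩
  refine Fin.addCases (fun i => ?_) (fun i => ?_) i
  · simpa using hu i
  · simpa using hv i

theorem smul_mem_cpCone (hK : ∀ c : ℝ, 0 ≤ c → ∀ u ∈ K, c • u ∈ K) {c : ℝ} (hc : 0 ≤ c)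
    {X : Matrix (Fin n) (Fin n) ℝ} (hX : X ∈ cpCone K) : c • X ∈ cpCone K := by
  obtain ⟨k, u, hu, rfl⟩ := hX
  refine ⟨k, fun i => √c • u i, fun i => hK _ (Real.sqrt_nonneg c) _ (hu i), ?_⟩
  simp only [Finset.smul_sum, smul_vecMulVec, vecMulVec_smul, smul_smul, Real.mul_self_sqrt hc]

theorem convex_cpCone (hK : ∀ c : ℝ, 0 ≤ c → ∀ u ∈ K, c • u ∈ K) : Convex ℝ (cpCone K) :=
  fun _ hX _ hY _ _ ha hb _ =>
    add_mem_cpCone (smul_mem_cpCone hK ha hX) (smul_mem_cpCone hK hb hY)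

theorem trace_transpose_mul_vecMulVec (M : Matrix (Fin n) (Fin n) ℝ) (u : Fin n → ℝ) :
    (Mᵀ * vecMulVec u u).trace = u ⬝ᵥ M *ᵥ u := by
  rw [mul_vecMulVec, trace_vecMulVec, mulVec_transpose, ← dotProduct_mulVec]

theorem exists_trace_transpose_mul_eq (f : Matrix (Fin n) (Fin n) ℝ →ₗ[ℝ] ℝ) :
    ∃ M : Matrix (Fin n) (Fin n) ℝ, ∀ X, f X = (Mᵀ * X).trace := by
  refine ⟨of fun i j => f (single i j 1), fun X => ?_⟩
  conv_lhs => rw [matrix_eq_sum_single X]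
  simp only [map_sum, trace, diag, mul_apply, transpose_apply, of_apply]
  rw [Finset.sum_comm]
  refine Finset.sum_congr rfl fun j _ => Finset.sum_congr rfl fun i _ => ?_
  rw [mul_comm, ← smul_eq_mul, ← map_smul, smul_single, smul_eq_mul, mul_one]

end CompletelyPositive

section SecondOrderCone

variable {n : ℕ} [NeZero n]

theorem mem_soc_iff_s4 {x : Fin n → ℝ} : x ∈ soc n ↔ 0 ≤ x 0 ∧ x ⬝ᵥ x ≤ 2 * x 0 ^ 2 := by
  have h : (∑ i, if i = 0 then 0 else x i ^ 2) = x ⬝ᵥ x - x 0 ^ 2 := by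
    rw [dotProduct, ← Finset.add_sum_erase _ _ (Finset.mem_univ (0 : Fin n)),
      ← Finset.add_sum_erase Finset.univ (fun i => x i * x i) (Finset.mem_univ (0 : Fin n))]
    have : ∑ i ∈ Finset.univ.erase 0, (if i = 0 then 0 else x i ^ 2)
        = ∑ i ∈ Finset.univ.erase 0, x i * x i :=
      Finset.sum_congr rfl fun i hi => by rw [if_neg (Finset.ne_of_mem_erase hi), sq]
    rw [this, if_pos rfl]
    ring
  rw [soc, Set.mem_ofPred_eq, Real.sqrt_le_iff, h, sub_le_iff_le_add, two_mul]

theorem smul_mem_soc (c : ℝ) (hc : 0 ≤ c) (x : Fin n → ℝ) (hx : x ∈ soc n) : c • x ∈ soc n := by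
  rw [mem_soc_iff_s4] at *
  simp only [Pi.smul_apply, smul_eq_mul, smul_dotProduct, dotProduct_smul]
  exact ⟨mul_nonneg hc hx.1, by nlinarith [mul_le_mul_of_nonneg_left hx.2 (mul_nonneg hc hc)]⟩

theorem Jmat_mulVec (x : Fin n → ℝ) : Jmat n *ᵥ x = (2 * x 0) • Pi.single 0 1 - x := by
  ext i
  rw [Jmat, mulVec_diagonal]
  rcases eq_or_ne i 0 with rfl | hi
  · simp
    ring
  · simp [hi]

theorem Jmat_mul_Jmat : Jmat n * Jmat n = 1 := by
  rw [Jmat, diagonal_mul_diagonal, ← diagonal_one]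
  congr 1
  ext i
  split_ifs <;> norm_num

theorem Jmat_transpose : (Jmat n)ᵀ = Jmat n := diagonal_transpose _

theorem dotProduct_Jmat_mulVec (x y : Fin n → ℝ) :
    x ⬝ᵥ Jmat n *ᵥ y = 2 * (x 0 * y 0) - x ⬝ᵥ y := by
  rw [Jmat_mulVec, dotProduct_sub, dotProduct_smul, dotProduct_single]
  simp only [smul_eq_mul]
  ring

theorem dotProduct_le_of_mem_soc {x y : Fin n → ℝ} (hx : x ∈ soc n) (hy : y ∈ soc n) :
    x ⬝ᵥ y ≤ 2 * (x 0 * y 0) := by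
  rw [mem_soc_iff_s4] at hx hy
  have h := Finset.sum_mul_sq_le_sq_mul_sq Finset.univ x y
  simp only [sq (x _), sq (y _)] at h
  change (x ⬝ᵥ y) ^ 2 ≤ (x ⬝ᵥ x) * (y ⬝ᵥ y) at h
  refine abs_le_of_sq_le_sq' (h.trans ?_) (mul_nonneg two_pos.le (mul_nonneg hx.1 hy.1)) |>.2
  calc (x ⬝ᵥ x) * (y ⬝ᵥ y) ≤ (2 * x 0 ^ 2) * (2 * y 0 ^ 2) :=
        mul_le_mul hx.2 hy.2 (Finset.sum_nonneg fun i _ => mul_self_nonneg (y i)) (by positivity)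
    _ = _ := by ring

theorem Jmat_mulVec_mem_dualCone {x : Fin n → ℝ} (hx : x ∈ soc n) :
    Jmat n *ᵥ x ∈ dualCone (soc n) := fun y hy => by
  rw [dotProduct_Jmat_mulVec]
  linarith [dotProduct_le_of_mem_soc hy hx]

theorem dualCone_soc_subset : dualCone (soc n) ⊆ soc n := fun y hy => by
  have h0 : 0 ≤ y 0 := by
    have := hy (Pi.single 0 1) (mem_soc_iff_s4.2 (by simp))
    simpa using this
  refine mem_soc_iff_s4.2 ⟨h0, ?_⟩
  by_contra! hlt
  set r := √(y ⬝ᵥ y - y 0 ^ 2) with hr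
  have hsq : r ^ 2 = y ⬝ᵥ y - y 0 ^ 2 := Real.sq_sqrt (by nlinarith)
  have hyr : y 0 < r := Real.lt_sqrt_of_sq_lt (by linarith)
  have h := hy ((y 0 + r) • Pi.single 0 1 - y) (mem_soc_iff_s4.2 ⟨by simp; linarith, ?_⟩)
  · simp only [sub_dotProduct, smul_dotProduct, single_dotProduct, smul_eq_mul, one_mul] at h
    nlinarith
  · simp only [sub_dotProduct, dotProduct_sub, smul_dotProduct, dotProduct_smul,
      single_dotProduct, dotProduct_single, smul_eq_mul, Pi.sub_apply, Pi.smul_apply,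
      Pi.single_eq_same, one_mul, mul_one]
    nlinarith

/-- Orthogonal elements of the second order cone are reflections of each other, up to scaling. -/
theorem smul_eq_smul_Jmat_mulVec {x y : Fin n → ℝ} (hx : x ∈ soc n) (hy : y ∈ soc n)
    (hxy : x ⬝ᵥ y = 0) : x 0 • y = y 0 • Jmat n *ᵥ x := by
  rw [← sub_eq_zero, ← dotProduct_self_eq_zero]
  have hJ : (Jmat n *ᵥ x) ⬝ᵥ (Jmat n *ᵥ x) = x ⬝ᵥ x := by
    rw [dotProduct_mulVec, vecMul_mulVec, Jmat_transpose, Jmat_mul_Jmat, vecMul_one]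
  have hJy : y ⬝ᵥ Jmat n *ᵥ x = 2 * (y 0 * x 0) := by
    rw [dotProduct_Jmat_mulVec, dotProduct_comm y x, hxy, sub_zero]
  refine le_antisymm ?_ (Finset.sum_nonneg fun i _ => mul_self_nonneg _)
  rw [mem_soc_iff_s4] at hx hy
  simp only [sub_dotProduct, dotProduct_sub, smul_dotProduct, dotProduct_smul, hJ, hJy,
    dotProduct_comm (Jmat n *ᵥ x) y, smul_eq_mul]
  nlinarith [mul_le_mul_of_nonneg_left hx.2 (sq_nonneg (y 0)),
    mul_le_mul_of_nonneg_left hy.2 (sq_nonneg (x 0))]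

theorem eq_zero_of_mem_soc {x : Fin n → ℝ} (hx : x ∈ soc n) (h0 : x 0 = 0) : x = 0 := by
  rw [mem_soc_iff_s4, h0] at hx
  exact dotProduct_self_eq_zero.1 (le_antisymm (by simpa using hx.2)
    (Finset.sum_nonneg fun i _ => mul_self_nonneg _))

/-- A matrix whose quadratic form is nonnegative on the second order cone gives a
Z-transformation `-JM`. -/
theorem isZTransf_neg_Jmat_mul {M : Matrix (Fin n) (Fin n) ℝ}
    (hM : ∀ u ∈ soc n, 0 ≤ u ⬝ᵥ M *ᵥ u) : IsZTransf (soc n) (-(Jmat n * M)) := by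
  intro x hx y hy hxy
  have hys := dualCone_soc_subset hy
  have hx0 := (mem_soc_iff_s4.1 hx).1
  rcases hx0.eq_or_lt' with h0 | h0
  · simp [eq_zero_of_mem_soc hx h0]
  · have h := smul_eq_smul_Jmat_mulVec hx hys hxy
    have key : x 0 * ((-(Jmat n * M)) *ᵥ x ⬝ᵥ y) = -(y 0 * (x ⬝ᵥ M *ᵥ x)) := by
      rw [← smul_eq_mul, ← dotProduct_smul, h, dotProduct_smul, smul_eq_mul, neg_mulVec,
        neg_dotProduct, ← mulVec_mulVec, dotProduct_mulVec, vecMul_mulVec, Jmat_transpose,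
        Jmat_mul_Jmat, vecMul_one, dotProduct_comm, mul_neg]
    have := mul_nonneg (mem_soc_iff_s4.1 hys).1 (hM x hx)
    by_contra! hpos
    nlinarith [mul_pos h0 hpos]

theorem isCompact_soc_slice : IsCompact {u : Fin n → ℝ | u ∈ soc n ∧ u 0 = 1} := by
  refine Metric.isCompact_of_isClosed_isBounded ?_ ?_
  · simp only [mem_soc_iff_s4, dotProduct, Set.ofPred_and]
    refine ((isClosed_le ?_ ?_).inter (isClosed_le ?_ ?_)).inter (isClosed_eq ?_ ?_) <;> fun_prop
  · refine (Metric.isBounded_closedBall (x := 0) (r := 2)).subset fun u ⟨hu, h0⟩ => ?_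
    rw [mem_closedBall_zero_iff, pi_norm_le_iff_of_nonneg two_pos.le]
    intro i
    rw [mem_soc_iff_s4, h0] at hu
    have := Finset.single_le_sum (f := fun i => u i * u i) (fun i _ => mul_self_nonneg _)
      (Finset.mem_univ i)
    have h2 : u i * u i ≤ 2 := this.trans (hu.2.trans (by norm_num))
    exact abs_le_of_sq_le_sq (by nlinarith) two_pos.le

/-- Separation of a matrix from the completely positive cone of the second order cone. -/
theorem exists_trace_neg_of_notMem_cpCone {D : Matrix (Fin n) (Fin n) ℝ}
    (hD : D ∉ cpCone (soc n)) : ∃ M : Matrix (Fin n) (Fin n) ℝ,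
      (∀ u ∈ soc n, 0 ≤ u ⬝ᵥ M *ᵥ u) ∧ (Mᵀ * D).trace < 0 := by
  have : LocallyConvexSpace ℝ (Matrix (Fin n) (Fin n) ℝ) :=
    inferInstanceAs (LocallyConvexSpace ℝ (Fin n → Fin n → ℝ))
  set S : Set (Matrix (Fin n) (Fin n) ℝ) :=
    (fun u => vecMulVec u u) '' {u : Fin n → ℝ | u ∈ soc n ∧ u 0 = 1} with hS
  have hcomp : IsCompact (convexHull ℝ S) :=
    (isCompact_soc_slice.image
      (continuous_id.matrix_vecMulVec continuous_id)).convexHull_of_finiteDimensional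
  have hsub : convexHull ℝ S ⊆ cpCone (soc n) := by
    refine convexHull_min ?_ (convex_cpCone smul_mem_soc)
    rintro _ ⟨u, hu, rfl⟩
    exact vecMulVec_self_mem_cpCone hu.1
  let g : StrongDual ℝ (Matrix (Fin n) (Fin n) ℝ) :=
    LinearMap.toContinuousLinearMap (entryLinearMap ℝ ℝ 0 0)
  have hg : ∀ X ∈ convexHull ℝ S, g X = 1 := by
    refine fun X hX => convexHull_min (t := {X | g X = 1}) ?_
      (convex_hyperplane g.toLinearMap.isLinear 1) hX
    rintro _ ⟨u, hu, rfl⟩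
    simp [g, vecMulVec_apply, hu.2]
  obtain ⟨f, hf, hfD⟩ :=
    exists_strongDual_neg_of_notMem_cone (convex_convexHull ℝ S) hcomp g hg
    (d := D)
    (fun h => hD (by rw [h]; exact zero_mem_cpCone))
    (fun c hc X hX h => hD (by rw [h]; exact smul_mem_cpCone smul_mem_soc hc.le (hsub hX)))
  obtain ⟨M, hM⟩ := exists_trace_transpose_mul_eq f.toLinearMap
  have hM' : ∀ X, f X = (Mᵀ * X).trace := hM
  refine ⟨M, fun u hu => ?_, hM' D ▸ hfD⟩
  rcases (mem_soc_iff_s4.1 hu).1.eq_or_lt' with h0 | h0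
  · simp [eq_zero_of_mem_soc hu h0]
  · have hv := hf _ (subset_convexHull ℝ S (Set.mem_image_of_mem _
      (show (u 0)⁻¹ • u ∈ {u : Fin n → ℝ | u ∈ soc n ∧ u 0 = 1} from
        ⟨smul_mem_soc _ (inv_nonneg.2 h0.le) _ hu, by simp [h0.ne']⟩)))
    rw [hM', trace_transpose_mul_vecMulVec, mulVec_smul, dotProduct_smul, smul_dotProduct,
      smul_smul, smul_eq_mul] at hv
    exact nonneg_of_mul_nonneg_right hv (by positivity)

end SecondOrderCone

theorem stmt4 (n : ℕ) [NeZero n] (hn : 1 < n) :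
    {B : Matrix (Fin n) (Fin n) ℝ | ∀ A, IsZTransf (soc n) A → 0 ≤ (Bᵀ * A).trace} =
      {B : Matrix (Fin n) (Fin n) ℝ | B.trace = 0 ∧ -(Jmat n * B) ∈ cpCone (soc n)} := by
  ext B
  rw [Set.mem_ofPred_eq, Set.mem_ofPred_eq]
  constructor
  · intro hB
    refine ⟨le_antisymm ?_ ?_, ?_⟩
    · have := hB (-1) fun x _ y _ h => by rw [neg_mulVec, one_mulVec, neg_dotProduct, h, neg_zero]
      simpa using this
    · have := hB 1 fun x _ y _ h => by rw [one_mulVec, h]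
      simpa using this
    · by_contra hD
      obtain ⟨M, hM, hneg⟩ := exists_trace_neg_of_notMem_cpCone hD
      have h := hB _ (isZTransf_neg_Jmat_mul hM)
      rw [← trace_transpose, transpose_mul, transpose_transpose, transpose_neg, transpose_mul,
        Jmat_transpose, neg_mul, Matrix.mul_assoc, ← mul_neg] at h
      exact hneg.not_ge h
  · rintro ⟨htr, k, u, hu, hX⟩ A hA
    have hB : B = -∑ i, vecMulVec (Jmat n *ᵥ u i) (u i) := by
      simp only [← mul_vecMulVec, ← Matrix.mul_sum, ← hX]
      rw [mul_neg, neg_neg, ← Matrix.mul_assoc, Jmat_mul_Jmat, Matrix.one_mul]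
    have hJ : ∀ i, 0 ≤ u i ⬝ᵥ Jmat n *ᵥ u i := fun i =>
      Jmat_mulVec_mem_dualCone (hu i) _ (hu i)
    have hsum : ∑ i, u i ⬝ᵥ Jmat n *ᵥ u i = 0 := by
      rw [hB, trace_neg, trace_sum, neg_eq_zero] at htr
      simpa only [trace_vecMulVec, dotProduct_comm (Jmat n *ᵥ _)] using htr
    have hzero := (Finset.sum_eq_zero_iff_of_nonneg fun i _ => hJ i).1 hsum
    rw [hB, transpose_neg, transpose_sum, neg_mul, Matrix.sum_mul, trace_neg, trace_sum,
      neg_nonneg]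
    refine Finset.sum_nonpos fun i hi => ?_
    rw [transpose_vecMulVec, vecMulVec_mul, trace_vecMulVec, dotProduct_comm, ← dotProduct_mulVec,
      dotProduct_comm]
    exact hA _ (hu i) _ (Jmat_mulVec_mem_dualCone (hu i)) (hzero i hi)
end
end
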